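/- arXiv:2306.06695 — 2 statements merged into one kernel-verified Lean document; each statement's English description precedes it below -/
import Mathlib

section
/- In the once-punctured convex m-gon P*_m (m ≥ 2), any two distinct maximal arcs cross, and every triangulation of P*_m contains exactly one maximal arc. -/
/-!
Vertices of the once-punctured convex `m`-gon `P*_m` are identified with `ZMod m`.
An arc is an equivalence class `[(a,b)]` of pairs of integers with
`a < b ≤ a + m` and `b - a ≥ 2`, modulo `(a,b) ∼ (a+m, b+m)`.  Each class has a unique
representative with `0 ≤ a < m`; we identify arcs with these canonical representatives,
i.e. with pairs `p : ℤ × ℤ` satisfying `IsPArc m p` below.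
Blue is encoded by the Boolean value `true`, red by `false`.
-/

namespace Punc

/-- `p` is (the canonical representative of) an arc of `P*_m`:
`0 ≤ p.1 < m`, `p.1 < p.2 ≤ p.1 + m` and `p.2 - p.1 ≥ 2`. -/
def IsPArc (m : ℕ) (p : ℤ × ℤ) : Prop :=
  0 ≤ p.1 ∧ p.1 < (m : ℤ) ∧ p.1 + 2 ≤ p.2 ∧ p.2 ≤ p.1 + (m : ℤ)

/-- The arcs `[(a,b)] = p` and `[(c,d)] = q` cross: there is an integer `k` with
`a + km < c < b + km < d` or with `c < a + km < d < b + km`. -/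
def PCross (m : ℕ) (p q : ℤ × ℤ) : Prop :=
  ∃ k : ℤ, (p.1 + k * m < q.1 ∧ q.1 < p.2 + k * m ∧ p.2 + k * m < q.2) ∨
    (q.1 < p.1 + k * m ∧ p.1 + k * m < q.2 ∧ q.2 < p.2 + k * m)

/-- The arc `p` is the maximal arc based at `p.1 mod m`, i.e. `p.2 - p.1 = m`. -/
def IsMaximalArc (m : ℕ) (p : ℤ × ℤ) : Prop :=
  IsPArc m p ∧ p.2 - p.1 = (m : ℤ)

/-- A triangulation of `P*_m`: a set of `m - 1` pairwise non-crossing arcs. -/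
def IsPTriangulation (m : ℕ) (T : Finset (ℤ × ℤ)) : Prop :=
  T.card = m - 1 ∧ (∀ p ∈ T, IsPArc m p) ∧
    ∀ p ∈ T, ∀ q ∈ T, p ≠ q → ¬ PCross m p q

/-- A bicolouring: a function from the vertices to {red, blue} attaining both values
(`true` = blue, `false` = red). -/
def IsBicolouring (m : ℕ) (c : ZMod m → Bool) : Prop :=
  (∃ v, c v = true) ∧ (∃ v, c v = false)

/-- A bicolouring is non-trivial if some arc has both endpoints red. -/
def IsNontrivialBicolouring (m : ℕ) (c : ZMod m → Bool) : Prop :=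
  IsBicolouring m c ∧
    ∃ p : ℤ × ℤ, IsPArc m p ∧ c (p.1 : ZMod m) = false ∧ c (p.2 : ZMod m) = false

/-- An arc is permitted if at least one of its endpoints is blue. -/
def Permitted (m : ℕ) (c : ZMod m → Bool) (p : ℤ × ℤ) : Prop :=
  c (p.1 : ZMod m) = true ∨ c (p.2 : ZMod m) = true

/-- A permissible triangulation: a triangulation all of whose arcs are permitted. -/
def IsPermissible (m : ℕ) (c : ZMod m → Bool) (T : Finset (ℤ × ℤ)) : Prop :=
  IsPTriangulation m T ∧ ∀ p ∈ T, Permitted m c p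

/-- Two permissible triangulations are joined in the flip graph of permissible
triangulations: there is a finite sequence of permissible triangulations from one to the
other in which consecutive triangulations share exactly `m - 2` arcs. -/
def PermFlipJoined (m : ℕ) (c : ZMod m → Bool) (T₁ T₂ : Finset (ℤ × ℤ)) : Prop :=
  ∃ n : ℕ, ∃ f : Fin (n + 1) → Finset (ℤ × ℤ),
    f 0 = T₁ ∧ f (Fin.last n) = T₂ ∧ (∀ i, IsPermissible m c (f i)) ∧
    ∀ i : Fin n, (f i.castSucc ∩ f i.succ).card = m - 2


/-- The `m`-periodic family of integer intervals lifting the arcs of `T`. -/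
def Lift (m : ℕ) (T : Finset (ℤ × ℤ)) (a b : ℤ) : Prop :=
  ∃ k : ℤ, (a + k * m, b + k * m) ∈ T

/-- `v` is the apex of the triangle lying under the interval `(a, b)`: the largest `v` in its
interior for which `(a, v)` is a side or a lifted arc. -/
def IsApex (m : ℕ) (T : Finset (ℤ × ℤ)) (a b v : ℤ) : Prop :=
  a < v ∧ v < b ∧ (v = a + 1 ∨ Lift m T a v) ∧ ∀ w, v < w → w < b → ¬ Lift m T a w

lemma lift_of_mem {m : ℕ} {T : Finset (ℤ × ℤ)} {p : ℤ × ℤ} (hp : p ∈ T) :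
    Lift m T p.1 p.2 := ⟨0, by simpa using hp⟩

lemma lift_add_mul {m : ℕ} {T : Finset (ℤ × ℤ)} {a b : ℤ} (k : ℤ) :
    Lift m T (a + k * m) (b + k * m) ↔ Lift m T a b := by
  constructor
  · rintro ⟨l, hl⟩
    refine ⟨k + l, ?_⟩
    convert hl using 2 <;> ring
  · rintro ⟨l, hl⟩
    refine ⟨l - k, ?_⟩
    convert hl using 2 <;> ring

lemma IsApex.add_mul {m : ℕ} {T : Finset (ℤ × ℤ)} {a b v : ℤ} (h : IsApex m T a b v) (k : ℤ) :
    IsApex m T (a + k * m) (b + k * m) (v + k * m) := by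
  obtain ⟨h₁, h₂, h₃, h₄⟩ := h
  refine ⟨by lia, by lia, ?_, fun w hvw hwb hw => ?_⟩
  · rcases h₃ with h₃ | h₃
    · left; lia
    · exact Or.inr ((lift_add_mul k).2 h₃)
  · refine h₄ (w - k * m) (by lia) (by lia) ((lift_add_mul k).1 ?_)
    simpa using hw

lemma exists_isApex (m : ℕ) (T : Finset (ℤ × ℤ)) {a b : ℤ} (hab : a + 2 ≤ b) :
    ∃ v, IsApex m T a b v := by
  obtain ⟨v, ⟨h₁, h₂, h₃⟩, hmax⟩ := Int.exists_greatest_of_bdd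
    (P := fun v => a < v ∧ v < b ∧ (v = a + 1 ∨ Lift m T a v))
    ⟨b, fun z hz => hz.2.1.le⟩ ⟨a + 1, by lia, by lia, Or.inl rfl⟩
  refine ⟨v, h₁, h₂, h₃, fun w hvw hwb hw => ?_⟩
  have := hmax w ⟨by lia, hwb, Or.inr hw⟩
  lia

lemma IsPTriangulation.not_lift_cross {m : ℕ} {T : Finset (ℤ × ℤ)} (hT : IsPTriangulation m T)
    {a b c d : ℤ} (hab : Lift m T a b) (hcd : Lift m T c d) : ¬ (a < c ∧ c < b ∧ b < d) := by
  rintro ⟨h₁, h₂, h₃⟩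
  obtain ⟨k, hk⟩ := hab
  obtain ⟨l, hl⟩ := hcd
  by_cases hne : ((a + k * m, b + k * m) : ℤ × ℤ) = (c + l * m, d + l * m)
  · obtain ⟨-, -, -, hlen⟩ := hT.2.1 _ hk
    simp only [Prod.mk.injEq] at hne hlen
    have hpos : 0 < (k - l) * (m : ℤ) := by lia
    have hkl : 0 < k - l := by
      by_contra! hle
      nlinarith
    nlinarith
  · refine hT.2.2 _ hk _ hl hne ⟨l - k, Or.inl ?_⟩
    have : (l - k) * (m : ℤ) = l * m - k * m := by ring
    simp only [this]
    lia

lemma IsPTriangulation.isApex_unique {m : ℕ} {T : Finset (ℤ × ℤ)} (hT : IsPTriangulation m T)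
    {a b c d v : ℤ} (hab : Lift m T a b) (hcd : Lift m T c d)
    (hv : IsApex m T a b v) (hv' : IsApex m T c d v) : a = c ∧ b = d := by
  obtain ⟨h₁, h₂, h₃, h₄⟩ := hv
  obtain ⟨h₁', h₂', h₃', h₄'⟩ := hv'
  have hac : a = c := by
    rcases lt_trichotomy a c with h | h | h
    · exact absurd ⟨h, h₁', h₂'⟩ (hT.not_lift_cross (h₃.resolve_left (by lia)) hcd)
    · exact h
    · exact absurd ⟨h, h₁, h₂⟩ (hT.not_lift_cross (h₃'.resolve_left (by lia)) hab)
  subst hac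
  refine ⟨rfl, ?_⟩
  rcases lt_trichotomy b d with h | h | h
  · exact absurd hab (h₄' b h₂ h)
  · exact h
  · exact absurd hcd (h₄ d h₂' h)

lemma pcross_of_isMaximalArc {m : ℕ} {p q : ℤ × ℤ} (hp : IsMaximalArc m p)
    (hq : IsMaximalArc m q) (hpq : p ≠ q) : PCross m p q := by
  obtain ⟨⟨hp₁, hp₂, hp₃, hp₄⟩, hp₅⟩ := hp
  obtain ⟨⟨hq₁, hq₂, hq₃, hq₄⟩, hq₅⟩ := hq
  have hne : p.1 ≠ q.1 := fun h => hpq (Prod.ext h (by lia))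
  refine ⟨0, ?_⟩
  rcases lt_or_gt_of_ne hne with h | h
  · left; lia
  · right; lia

lemma exists_eq_add_mul_of_intCast_eq {m : ℕ} {x y : ℤ} (h : (x : ZMod m) = y) :
    ∃ k : ℤ, x = y + k * m := by
  obtain ⟨k, hk⟩ := (ZMod.intCast_eq_intCast_iff_dvd_sub y x m).1 h.symm
  exact ⟨k, by linarith [mul_comm (m : ℤ) k]⟩

lemma IsPTriangulation.exists_isMaximalArc {m : ℕ} (hm : 2 ≤ m) {T : Finset (ℤ × ℤ)}
    (hT : IsPTriangulation m T) : ∃ p ∈ T, IsMaximalArc m p := by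
  by_contra! hno
  have : NeZero m := ⟨by lia⟩
  have hne : T.Nonempty := by
    rw [← Finset.card_pos, hT.1]
    lia
  obtain ⟨q, hq, hqmax⟩ := T.exists_max_image (fun p => p.2 - p.1) hne
  have hlen : ∀ {c d : ℤ}, Lift m T c d → d - c ≤ q.2 - q.1 := by
    rintro c d ⟨k, hk⟩
    simpa using hqmax _ hk
  choose! f hf using fun p hp => exists_isApex m T (hT.2.1 p hp).2.2.1
  have hshift : ∀ p ∈ T, ∀ x : ℤ, (f p : ZMod m) = x →
      ∃ k : ℤ, Lift m T (p.1 + k * m) (p.2 + k * m) ∧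
        IsApex m T (p.1 + k * m) (p.2 + k * m) x := by
    intro p hp x hx
    obtain ⟨k, hk⟩ := exists_eq_add_mul_of_intCast_eq hx.symm
    exact ⟨k, (lift_add_mul k).2 (lift_of_mem hp), hk ▸ (hf p hp).add_mul k⟩
  have hcard : T.card ≤ (((Finset.univ : Finset (ZMod m)).erase q.1).erase q.2).card := by
    refine Finset.card_le_card_of_injOn (fun p => (f p : ZMod m)) (fun p hp => ?_) ?_
    · simp only [Finset.coe_erase, Set.mem_sdiff, Set.mem_singleton_iff, Finset.coe_univ,
        Set.mem_univ, true_and]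
      refine ⟨fun h => ?_, fun h => ?_⟩
      · obtain ⟨k, hk, h₁, h₂, -⟩ := hshift p hp _ h
        have := hlen hk
        have := hT.not_lift_cross hk (lift_of_mem hq)
        have := hT.not_lift_cross (lift_of_mem hq) hk
        have := hT.2.1 q hq
        unfold IsPArc at this
        lia
      · obtain ⟨k, hk, h₁, h₂, -⟩ := hshift p hp _ h
        have := hlen hk
        have := hT.not_lift_cross hk (lift_of_mem hq)
        have := hT.not_lift_cross (lift_of_mem hq) hk
        have := hT.2.1 q hq
        unfold IsPArc at this
        lia
    · intro p hp r hr hpr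
      obtain ⟨k, hk, hkv⟩ := hshift p hp _ hpr
      obtain ⟨h₁, h₂⟩ := hT.isApex_unique hk (lift_of_mem hr) hkv (hf r hr)
      obtain ⟨hp₁, hp₂, -⟩ := hT.2.1 p hp
      obtain ⟨hr₁, hr₂, -⟩ := hT.2.1 r hr
      have hk₀ : k = 0 := by
        have : k < 1 := by by_contra! h; nlinarith
        have : -1 < k := by by_contra! h; nlinarith
        lia
      subst hk₀
      exact Prod.ext (by lia) (by lia)
  have hends : (q.2 : ZMod m) ≠ q.1 := by
    intro h
    obtain ⟨k, hk⟩ := exists_eq_add_mul_of_intCast_eq h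
    obtain ⟨h₁, h₂, h₃, h₄⟩ := hT.2.1 q hq
    have hlt : q.2 - q.1 ≠ m := fun h => hno q hq ⟨hT.2.1 q hq, h⟩
    have : k < 1 := by
      by_contra! h
      have : (m : ℤ) ≤ k * m := by nlinarith
      lia
    nlinarith
  rw [Finset.card_erase_of_mem (by simp [hends]), Finset.card_erase_of_mem (by simp),
    Finset.card_univ, ZMod.card, hT.1] at hcard
  lia

/-- In `P*_m` (`m ≥ 2`), any two distinct maximal arcs cross, and
every triangulation contains exactly one maximal arc. -/
theorem maximal_arcs (m : ℕ) (hm : 2 ≤ m) :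
    (∀ p q : ℤ × ℤ, IsMaximalArc m p → IsMaximalArc m q → p ≠ q → PCross m p q) ∧
      ∀ T : Finset (ℤ × ℤ), IsPTriangulation m T →
        ∃! p : ℤ × ℤ, p ∈ T ∧ IsMaximalArc m p := by
  refine ⟨fun p q => pcross_of_isMaximalArc, fun T hT => ?_⟩
  obtain ⟨p, hp, hmax⟩ := hT.exists_isMaximalArc hm
  refine ⟨p, ⟨hp, hmax⟩, fun q ⟨hq, hqmax⟩ => ?_⟩
  by_contra hne
  exact hT.2.2 q hq p hp hne (pcross_of_isMaximalArc hqmax hmax hne)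

end Punc
end

section
/- For the once-punctured convex m-gon P*_m (m ≥ 2): every set of m−2 pairwise non-crossing arcs is contained in exactly two triangulations, and any two triangulations of P*_m are joined by a finite sequence of triangulations in which consecutive triangulations share exactly m−2 arcs. (Thus the arc complex of P*_m is an (m−2)-dimensional pseudo-manifold.) -/
/-!
Vertices of the once-punctured convex `m`-gon `P*_m` are identified with `ZMod m`.
An arc is an equivalence class `[(a,b)]` of pairs of integers with
`a < b ≤ a + m` and `b - a ≥ 2`, modulo `(a,b) ∼ (a+m, b+m)`.  Each class has a unique
representative with `0 ≤ a < m`; we identify arcs with these canonical representatives,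
i.e. with pairs `p : ℤ × ℤ` satisfying `IsPArc m p` below.
Blue is encoded by the Boolean value `true`, red by `false`.
-/

namespace Punc

/-- Two triangulations of `P*_m` are joined in the flip graph: there is a finite
sequence of triangulations from one to the other in which consecutive triangulations
share exactly `m - 2` arcs. -/
def FlipJoined (m : ℕ) (T₁ T₂ : Finset (ℤ × ℤ)) : Prop :=
  ∃ n : ℕ, ∃ f : Fin (n + 1) → Finset (ℤ × ℤ),
    f 0 = T₁ ∧ f (Fin.last n) = T₂ ∧ (∀ i, IsPTriangulation m (f i)) ∧
    ∀ i : Fin n, (f i.castSucc ∩ f i.succ).card = m - 2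

/-- The chord `q` starts strictly inside the chord `p` and ends strictly after it. -/
def CrossLT (p q : ℤ × ℤ) : Prop := p.1 < q.1 ∧ q.1 < p.2 ∧ p.2 < q.2

/-- A set of pairwise non-crossing chords of length at least two in the integer interval
`[a, b]`; the chord `(a, b)` itself is allowed. -/
structure IsNCFamily (a b : ℤ) (F : Finset (ℤ × ℤ)) : Prop where
  left : ∀ p ∈ F, a ≤ p.1
  gap : ∀ p ∈ F, p.1 + 2 ≤ p.2
  right : ∀ p ∈ F, p.2 ≤ b
  nc : ∀ p ∈ F, ∀ q ∈ F, ¬ CrossLT p q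

/-- The chords of `F` contained in `[c, d]`. -/
def restrict (F : Finset (ℤ × ℤ)) (c d : ℤ) : Finset (ℤ × ℤ) :=
  F.filter fun p => c ≤ p.1 ∧ p.2 ≤ d

/-- `(c, d)` is a chord of `F` or a boundary edge. -/
def IsEdge (F : Finset (ℤ × ℤ)) (c d : ℤ) : Prop := d = c + 1 ∨ (c, d) ∈ F

section Interval

variable {a b : ℤ} {F : Finset (ℤ × ℤ)}

theorem mem_restrict {c d : ℤ} {p : ℤ × ℤ} :
    p ∈ restrict F c d ↔ p ∈ F ∧ c ≤ p.1 ∧ p.2 ≤ d := by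
  simp [restrict]

theorem IsNCFamily.mono (h : IsNCFamily a b F) {G : Finset (ℤ × ℤ)} (hG : G ⊆ F) :
    IsNCFamily a b G :=
  ⟨fun p hp => h.left p (hG hp), fun p hp => h.gap p (hG hp), fun p hp => h.right p (hG hp),
    fun p hp q hq => h.nc p (hG hp) q (hG hq)⟩

theorem IsNCFamily.to_restrict (h : IsNCFamily a b F) (c d : ℤ) :
    IsNCFamily c d (restrict F c d) := by
  simp only [restrict]
  constructor
  · intro p hp; exact (Finset.mem_filter.1 hp).2.1
  · intro p hp; exact h.gap p (Finset.mem_filter.1 hp).1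
  · intro p hp; exact (Finset.mem_filter.1 hp).2.2
  · intro p hp q hq; exact h.nc p (Finset.mem_filter.1 hp).1 q (Finset.mem_filter.1 hq).1

theorem IsNCFamily.insert_chord (h : IsNCFamily a b F) {z : ℤ × ℤ} (h1 : a ≤ z.1)
    (h2 : z.1 + 2 ≤ z.2) (h3 : z.2 ≤ b) (h4 : ∀ p ∈ F, ¬ CrossLT p z ∧ ¬ CrossLT z p) :
    IsNCFamily a b (insert z F) := by
  constructor
  · intro p hp
    rcases Finset.mem_insert.1 hp with rfl | hp
    exacts [h1, h.left p hp]
  · intro p hp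
    rcases Finset.mem_insert.1 hp with rfl | hp
    exacts [h2, h.gap p hp]
  · intro p hp
    rcases Finset.mem_insert.1 hp with rfl | hp
    exacts [h3, h.right p hp]
  · intro p hp q hq
    rw [Finset.mem_insert] at hp hq
    rcases hp with rfl | hp <;> rcases hq with rfl | hq
    · unfold CrossLT; omega
    · exact (h4 q hq).2
    · exact (h4 p hp).1
    · exact h.nc p hp q hq

theorem IsNCFamily.insert_top (h : IsNCFamily a b F) (hab : a + 2 ≤ b) :
    IsNCFamily a b (insert (a, b) F) := by
  refine h.insert_chord le_rfl hab le_rfl fun p hp => ?_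
  have := h.left p hp
  have := h.right p hp
  simp only [CrossLT]
  omega

theorem IsNCFamily.exists_split (h : IsNCFamily a b F) (hab : a + 2 ≤ b) :
    ∃ f, a < f ∧ f < b ∧ ∀ p ∈ F, p ≠ (a, b) → ¬ (p.1 < f ∧ f < p.2) := by
  by_cases hG : (F.filter fun p => p.1 = a ∧ p.2 < b).Nonempty
  · obtain ⟨q, hq, hmax⟩ := Finset.exists_max_image _ (fun p : ℤ × ℤ => p.2) hG
    simp only [Finset.mem_filter, and_imp] at hq hmax
    refine ⟨q.2, ?_, hq.2.2, fun p hp hne hs => ?_⟩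
    · have := h.gap q hq.1; omega
    · have h1 := h.left p hp
      have h2 := h.right p hp
      have h3 := h.nc q hq.1 p hp
      have h4 := hmax p hp
      have h5 : ¬ (p.1 = a ∧ p.2 = b) := fun hc => hne (Prod.ext hc.1 hc.2)
      simp only [CrossLT] at h3
      omega
  · refine ⟨a + 1, by omega, by omega, fun p hp hne hs => hG ⟨p, ?_⟩⟩
    have h1 := h.left p hp
    have h2 := h.right p hp
    have h5 : ¬ (p.1 = a ∧ p.2 = b) := fun hc => hne (Prod.ext hc.1 hc.2)
    simp only [Finset.mem_filter]
    refine ⟨hp, ?_⟩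
    omega

theorem IsNCFamily.card_erase_eq (h : IsNCFamily a b F) {f : ℤ} (haf : a < f) (hfb : f < b)
    (hf : ∀ p ∈ F, p ≠ (a, b) → ¬ (p.1 < f ∧ f < p.2)) :
    (F.erase (a, b)).card = (restrict F a f).card + (restrict F f b).card := by
  have : F.erase (a, b) = restrict F a f ∪ restrict F f b := by
    ext p
    simp only [Finset.mem_erase, Finset.mem_union, mem_restrict]
    constructor
    · rintro ⟨hne, hp⟩
      have := h.left p hp
      have := h.right p hp
      have := hf p hp hne
      have : p.2 ≤ f ∨ f ≤ p.1 := by omega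
      tauto
    · rintro (hp | hp)
      · exact ⟨fun hc => by simp only [hc] at hp; omega, hp.1⟩
      · exact ⟨fun hc => by simp only [hc] at hp; omega, hp.1⟩
  rw [this, Finset.card_union_of_disjoint]
  rw [Finset.disjoint_left]
  intro p hp hq
  rw [mem_restrict] at hp hq
  have := h.gap p hp.1
  omega

theorem IsNCFamily.card_le (h : IsNCFamily a b F) (hab : a < b) : (F.card : ℤ) + 1 ≤ b - a := by
  induction hn : (b - a).toNat using Nat.strong_induction_on generalizing a b F with
  | _ n ih =>
    by_cases hab2 : a + 2 ≤ b
    · obtain ⟨f, haf, hfb, hf⟩ := h.exists_split hab2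
      have hc := h.card_erase_eq haf hfb hf
      have h1 := ih (f - a).toNat (by omega) (h.to_restrict a f) haf rfl
      have h2 := ih (b - f).toNat (by omega) (h.to_restrict f b) hfb rfl
      have h3 := Finset.pred_card_le_card_erase (s := F) (a := (a, b))
      omega
    · have : F = ∅ := by
        rw [Finset.eq_empty_iff_forall_notMem]
        intro p hp
        have := h.left p hp
        have := h.right p hp
        have := h.gap p hp
        omega
      subst this
      simp only [Finset.card_empty]
      omega

theorem mem_of_insert_of_card (hcard : (F.card : ℤ) + 1 = b - a) {z : ℤ × ℤ}
    (hz : IsNCFamily a b (insert z F)) : z ∈ F := by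
  by_contra hzF
  have := hz.card_le (by omega)
  rw [Finset.card_insert_of_notMem hzF] at this
  push_cast at this
  omega

theorem IsNCFamily.isEdge_of_card (h : IsNCFamily a b F) (hab : a < b)
    (hcard : (F.card : ℤ) + 1 = b - a) : IsEdge F a b := by
  by_cases hab2 : a + 2 ≤ b
  · exact Or.inr (mem_of_insert_of_card hcard (h.insert_top hab2))
  · exact Or.inl (by omega)

theorem isEdge_of_restrict {c d x y : ℤ} (h : IsEdge (restrict F c d) x y) : IsEdge F x y :=
  h.imp_right fun h => (mem_restrict.1 h).1

/-- The chords of a non-crossing family, and its boundary edges, do not cross. -/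
theorem IsNCFamily.not_cross_of_isEdge (h : IsNCFamily a b F) {p : ℤ × ℤ} (hp : p ∈ F) {c d : ℤ}
    (he : IsEdge F c d) : ¬ CrossLT p (c, d) ∧ ¬ CrossLT (c, d) p := by
  rcases he with rfl | he
  · simp only [CrossLT]; omega
  · exact ⟨h.nc _ hp _ he, h.nc _ he _ hp⟩

/-- A chord that crosses the first diagonal of a quadrilateral but none of its sides is the
second diagonal. -/
theorem eq_second_diagonal {c g f d : ℤ} (hcg : c < g) (hgf : g < f) (hfd : f < d) {p : ℤ × ℤ}
    (h1 : ¬ CrossLT p (c, g) ∧ ¬ CrossLT (c, g) p) (h2 : ¬ CrossLT p (g, f) ∧ ¬ CrossLT (g, f) p)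
    (h3 : ¬ CrossLT p (f, d) ∧ ¬ CrossLT (f, d) p) (h4 : ¬ CrossLT p (c, d) ∧ ¬ CrossLT (c, d) p)
    (h : CrossLT p (c, f) ∨ CrossLT (c, f) p) : p = (g, d) := by
  obtain ⟨x, y⟩ := p
  simp only [CrossLT, Prod.mk.injEq] at *
  omega

/-- A chord that crosses the second diagonal of a quadrilateral but none of its sides is the
first diagonal. -/
theorem eq_first_diagonal {c g f d : ℤ} (hcg : c < g) (hgf : g < f) (hfd : f < d) {p : ℤ × ℤ}
    (h1 : ¬ CrossLT p (c, g) ∧ ¬ CrossLT (c, g) p) (h2 : ¬ CrossLT p (g, f) ∧ ¬ CrossLT (g, f) p)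
    (h3 : ¬ CrossLT p (f, d) ∧ ¬ CrossLT (f, d) p) (h4 : ¬ CrossLT p (c, d) ∧ ¬ CrossLT (c, d) p)
    (h : CrossLT p (g, d) ∨ CrossLT (g, d) p) : p = (c, f) := by
  obtain ⟨x, y⟩ := p
  simp only [CrossLT, Prod.mk.injEq] at *
  omega

/-- `c < g < f < d` span an empty quadrilateral of `F`. -/
structure IsQuad (F : Finset (ℤ × ℤ)) (c g f d : ℤ) : Prop where
  lt₁ : c < g
  lt₂ : g < f
  lt₃ : f < d
  side₁ : IsEdge F c g
  side₂ : IsEdge F g f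
  side₃ : IsEdge F f d
  side₄ : (c, d) ∈ F
  diag₁ : (c, f) ∉ F
  diag₂ : (g, d) ∉ F

theorem IsQuad.of_restrict {x y c g f d : ℤ}
    (h : IsQuad (restrict F x y) c g f d) : IsQuad F c g f d := by
  have h4 := mem_restrict.1 h.side₄
  have h1 := h.lt₁
  have h2 := h.lt₂
  have h3 := h.lt₃
  refine ⟨h1, h2, h3, isEdge_of_restrict h.side₁, isEdge_of_restrict h.side₂,
    isEdge_of_restrict h.side₃, h4.1, fun hc => h.diag₁ ?_, fun hc => h.diag₂ ?_⟩
  · exact mem_restrict.2 ⟨hc, h4.2.1, by have := h4.2.2; simp only at *; omega⟩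
  · exact mem_restrict.2 ⟨hc, by have := h4.2.1; simp only at *; omega, h4.2.2⟩

/-- A family with one chord missing splits into two full families if it does not contain the
longest chord. -/
theorem IsNCFamily.exists_split_of_card (h : IsNCFamily a b F)
    (hcard : (F.card : ℤ) + 2 = b - a) (htop : (a, b) ∉ F) :
    ∃ f, a < f ∧ f < b ∧ IsEdge F a f ∧ IsEdge F f b ∧
      ∀ p ∈ F, ¬ (p.1 < f ∧ f < p.2) := by
  obtain ⟨f, haf, hfb, hf⟩ := h.exists_split (by omega)
  have hc := h.card_erase_eq haf hfb hf
  rw [Finset.erase_eq_of_notMem htop] at hc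
  have h1 := (h.to_restrict a f).card_le haf
  have h2 := (h.to_restrict f b).card_le hfb
  refine ⟨f, haf, hfb, isEdge_of_restrict ((h.to_restrict a f).isEdge_of_card haf (by omega)),
    isEdge_of_restrict ((h.to_restrict f b).isEdge_of_card hfb (by omega)),
    fun p hp => hf p hp fun hc => htop (hc ▸ hp)⟩

theorem IsNCFamily.exists_isQuad (h : IsNCFamily a b F) (hcard : (F.card : ℤ) + 2 = b - a)
    (htop : (a, b) ∈ F) : ∃ c g f d, IsQuad F c g f d := by
  induction hn : (b - a).toNat using Nat.strong_induction_on generalizing a b F with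
  | _ n ih =>
    have hab2 := h.gap _ htop
    obtain ⟨f, haf, hfb, hf⟩ := h.exists_split hab2
    have hc := h.card_erase_eq haf hfb hf
    rw [Finset.card_erase_of_mem htop] at hc
    have hpos := Finset.card_pos.2 ⟨_, htop⟩
    have hL := h.to_restrict a f
    have hR := h.to_restrict f b
    have h1 := hL.card_le haf
    have h2 := hR.card_le hfb
    by_cases hLc : ((restrict F a f).card : ℤ) + 1 = f - a
    · by_cases hm : (f, b) ∈ restrict F f b
      · obtain ⟨c, g, k, d, hq⟩ := ih (b - f).toNat (by omega) hR (by omega) hm rfl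
        exact ⟨c, g, k, d, hq.of_restrict⟩
      · obtain ⟨g, hg1, hg2, hg3, hg4, -⟩ := hR.exists_split_of_card (by omega) hm
        refine ⟨a, f, g, b, haf, hg1, hg2, isEdge_of_restrict (hL.isEdge_of_card haf hLc),
          isEdge_of_restrict hg3, isEdge_of_restrict hg4, htop, fun hc => ?_, fun hc => hm ?_⟩
        · exact hf _ hc (by simp only [ne_eq, Prod.mk.injEq]; omega) ⟨haf, hg1⟩
        · exact mem_restrict.2 ⟨hc, le_rfl, le_rfl⟩
    · by_cases hm : (a, f) ∈ restrict F a f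
      · obtain ⟨c, g, k, d, hq⟩ := ih (f - a).toNat (by omega) hL (by omega) hm rfl
        exact ⟨c, g, k, d, hq.of_restrict⟩
      · obtain ⟨g, hg1, hg2, hg3, hg4, -⟩ := hL.exists_split_of_card (by omega) hm
        refine ⟨a, g, f, b, hg1, hg2, hfb, isEdge_of_restrict hg3, isEdge_of_restrict hg4,
          isEdge_of_restrict (hR.isEdge_of_card hfb (by omega)), htop, fun hc => hm ?_,
          fun hc => ?_⟩
        · exact mem_restrict.2 ⟨hc, le_rfl, le_rfl⟩
        · exact hf _ hc (by simp only [ne_eq, Prod.mk.injEq]; omega) ⟨hg2, hfb⟩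

theorem IsQuad.insert_diag₁ {c g f d : ℤ} (h : IsNCFamily a b F) (hq : IsQuad F c g f d) :
    IsNCFamily a b (insert (c, f) F) := by
  have h1 := h.left _ hq.side₄
  have h2 := h.right _ hq.side₄
  have h3 := hq.lt₁
  have h4 := hq.lt₂
  have h5 := hq.lt₃
  refine h.insert_chord h1 (by simp only; omega) (by simp only at *; omega) fun p hp => ?_
  rw [← not_or]
  intro hc
  have := eq_second_diagonal h3 h4 h5 (h.not_cross_of_isEdge hp hq.side₁)
    (h.not_cross_of_isEdge hp hq.side₂) (h.not_cross_of_isEdge hp hq.side₃)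
    (h.not_cross_of_isEdge hp (Or.inr hq.side₄)) hc
  exact hq.diag₂ (this ▸ hp)

theorem IsQuad.insert_diag₂ {c g f d : ℤ} (h : IsNCFamily a b F) (hq : IsQuad F c g f d) :
    IsNCFamily a b (insert (g, d) F) := by
  have h1 := h.left _ hq.side₄
  have h2 := h.right _ hq.side₄
  have h3 := hq.lt₁
  have h4 := hq.lt₂
  have h5 := hq.lt₃
  refine h.insert_chord (by simp only at *; omega) (by simp only; omega) h2 fun p hp => ?_
  rw [← not_or]
  intro hc
  have := eq_first_diagonal h3 h4 h5 (h.not_cross_of_isEdge hp hq.side₁)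
    (h.not_cross_of_isEdge hp hq.side₂) (h.not_cross_of_isEdge hp hq.side₃)
    (h.not_cross_of_isEdge hp (Or.inr hq.side₄)) hc
  exact hq.diag₁ (this ▸ hp)

theorem IsEdge.mono {c d : ℤ} {G : Finset (ℤ × ℤ)} (h : IsEdge F c d) (hG : F ⊆ G) :
    IsEdge G c d :=
  h.imp_right fun h => hG h

theorem IsQuad.eq_diag {c g f d : ℤ} (h : IsNCFamily a b F) (hcard : (F.card : ℤ) + 2 = b - a)
    (hq : IsQuad F c g f d) {z : ℤ × ℤ} (hzF : z ∉ F) (hz : IsNCFamily a b (insert z F)) :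
    z = (c, f) ∨ z = (g, d) := by
  have hzm := Finset.mem_insert_self z F
  have hsub := Finset.subset_insert z F
  by_cases hcr : CrossLT z (c, f) ∨ CrossLT (c, f) z
  · exact Or.inr <| eq_second_diagonal hq.lt₁ hq.lt₂ hq.lt₃
      (hz.not_cross_of_isEdge hzm (hq.side₁.mono hsub))
      (hz.not_cross_of_isEdge hzm (hq.side₂.mono hsub))
      (hz.not_cross_of_isEdge hzm (hq.side₃.mono hsub))
      (hz.not_cross_of_isEdge hzm (Or.inr (hsub hq.side₄))) hcr
  · rw [not_or] at hcr
    have hF' := hq.insert_diag₁ h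
    have hmem : z ∈ insert (c, f) F := by
      refine mem_of_insert_of_card (a := a) (b := b) ?_ (hF'.insert_chord (hz.left z hzm)
        (hz.gap z hzm) (hz.right z hzm) fun p hp => ?_)
      · rw [Finset.card_insert_of_notMem hq.diag₁]
        push_cast
        omega
      · rcases Finset.mem_insert.1 hp with rfl | hp
        · exact ⟨hcr.2, hcr.1⟩
        · exact ⟨hz.nc _ (hsub hp) _ hzm, hz.nc _ hzm _ (hsub hp)⟩
    exact Or.inl ((Finset.mem_insert.1 hmem).resolve_right hzF)

/-- Every chord of a full family is the long side of a triangle of the family. -/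
theorem IsNCFamily.exists_triangle (h : IsNCFamily a b F) (hcard : (F.card : ℤ) + 1 = b - a)
    {c d : ℤ} (hcd : (c, d) ∈ F) :
    ∃ f, c < f ∧ f < d ∧ IsEdge F c f ∧ IsEdge F f d := by
  obtain ⟨f, hcf, hfd, hf⟩ := (h.to_restrict c d).exists_split (h.gap _ hcd)
  have h1 := h.left _ hcd
  have h2 := h.right _ hcd
  simp only at h1 h2
  have key : ∀ p ∈ F, p ≠ (c, d) → c ≤ p.1 → p.2 ≤ d → ¬ (p.1 < f ∧ f < p.2) :=
    fun p hp hne h3 h4 => hf p (mem_restrict.2 ⟨hp, h3, h4⟩) hne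
  refine ⟨f, hcf, hfd, ?_, ?_⟩
  · by_cases hl : c + 2 ≤ f
    · refine Or.inr (mem_of_insert_of_card hcard (h.insert_chord h1 hl (by simp only; omega)
        fun p hp => ?_))
      have h3 := h.nc _ hcd _ hp
      have h4 := h.nc _ hp _ hcd
      have h5 := key p hp
      by_cases hpe : p = (c, d)
      · subst hpe; simp only [CrossLT]; omega
      · have h5 := h5 hpe
        simp only [CrossLT] at *
        omega
    · exact Or.inl (by omega)
  · by_cases hl : f + 2 ≤ d
    · refine Or.inr (mem_of_insert_of_card hcard (h.insert_chord (by simp only; omega) hl h2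
        fun p hp => ?_))
      have h3 := h.nc _ hcd _ hp
      have h4 := h.nc _ hp _ hcd
      have h5 := key p hp
      by_cases hpe : p = (c, d)
      · subst hpe; simp only [CrossLT]; omega
      · have h5 := h5 hpe
        simp only [CrossLT] at *
        omega
    · exact Or.inl (by omega)

/-- All chords of `[a, b]` that start at `a`. -/
noncomputable def fan (a b : ℤ) : Finset (ℤ × ℤ) := (Finset.Icc (a + 2) b).image fun c => (a, c)

theorem mem_fan {p : ℤ × ℤ} : p ∈ fan a b ↔ p.1 = a ∧ a + 2 ≤ p.2 ∧ p.2 ≤ b := by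
  obtain ⟨x, y⟩ := p
  simp only [fan, Finset.mem_image, Finset.mem_Icc, Prod.mk.injEq]
  constructor
  · rintro ⟨c, hc, rfl, rfl⟩; exact ⟨rfl, hc⟩
  · rintro ⟨rfl, h⟩; exact ⟨y, h, rfl, rfl⟩

theorem card_fan (hab : a < b) : ((fan a b).card : ℤ) + 1 = b - a := by
  rw [fan, Finset.card_image_of_injective _ (fun x y h => (Prod.mk.inj h).2), Int.card_Icc]
  omega

theorem isNCFamily_fan : IsNCFamily a b (fan a b) := by
  constructor
  · intro p hp; rw [mem_fan] at hp; omega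
  · intro p hp; rw [mem_fan] at hp; omega
  · intro p hp; rw [mem_fan] at hp; omega
  · intro p hp q hq; rw [mem_fan] at hp hq; simp only [CrossLT]; omega

/-- A full non-crossing family, that is, a triangulation of the polygon with vertices
`a, …, b`. -/
def IsFull (a b : ℤ) (F : Finset (ℤ × ℤ)) : Prop :=
  IsNCFamily a b F ∧ (F.card : ℤ) + 1 = b - a

/-- Two triangulations of the polygon with vertices `a, …, b` that differ by a flip. -/
def FullFlip (a b : ℤ) (F G : Finset (ℤ × ℤ)) : Prop :=
  IsFull a b F ∧ IsFull a b G ∧ ((F ∩ G).card : ℤ) + 2 = b - a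

theorem fan_subset_of_forall (htop : (a, b) ∈ F)
    (hF : ∀ d, a + 3 ≤ d → (a, d) ∈ F → (a, d - 1) ∈ F) : fan a b ⊆ F := by
  have key : ∀ n : ℕ, a + 2 ≤ b - n → (a, b - n) ∈ F := by
    intro n
    induction n with
    | zero => intro _; simpa using htop
    | succ n ih =>
      intro hn
      push_cast at hn ⊢
      have := hF (b - n) (by omega) (ih (by omega))
      rwa [sub_sub] at this
  rintro ⟨x, y⟩ hp
  rw [mem_fan] at hp
  obtain ⟨rfl, h1, h2⟩ := hp
  simp only at h1 h2
  have := key (b - y).toNat (by omega)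
  rwa [show b - ((b - y).toNat : ℤ) = y by omega] at this

/-- A triangulation that is not the fan at `a` admits a flip creating a chord at `a`. -/
theorem IsFull.exists_fullFlip (hab : a < b) (h : IsFull a b F) (hne : ¬ fan a b ⊆ F) :
    ∃ G, FullFlip a b F G ∧ (fan a b \ G).card < (fan a b \ F).card := by
  obtain ⟨hF, hcard⟩ := h
  have htop : (a, b) ∈ F := by
    rcases hF.isEdge_of_card hab hcard with h | h
    · refine absurd (fun p hp => ?_) hne
      rw [mem_fan] at hp
      omega
    · exact h
  have hex : ∃ d, a + 3 ≤ d ∧ (a, d) ∈ F ∧ (a, d - 1) ∉ F := by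
    by_contra! hc
    exact hne (fan_subset_of_forall htop hc)
  obtain ⟨d, had, hd, hd'⟩ := hex
  obtain ⟨e, hae, hed, hse, hsd⟩ := hF.exists_triangle hcard hd
  have hed' : d ≠ e + 1 := by
    rintro rfl
    rcases hse with h | h
    · omega
    · rw [add_sub_cancel_right] at hd'
      exact hd' h
  have hmem : (e, d) ∈ F := hsd.resolve_left hed'
  obtain ⟨f, hef, hfd, hsf, hsf'⟩ := hF.exists_triangle hcard hmem
  have hnot : (a, f) ∉ F := fun hc => hF.nc _ hc _ hmem ⟨hae, hef, hfd⟩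
  have hbd := hF.right _ hd
  simp only at hbd
  have hfam : IsNCFamily a b (insert (a, f) (F.erase (e, d))) := by
    refine (hF.mono (Finset.erase_subset _ _)).insert_chord le_rfl (by simp only; omega)
      (by simp only; omega) fun p hp => ?_
    rw [← not_or]
    intro hc
    have hp' := Finset.mem_erase.1 hp
    exact hp'.1 (eq_second_diagonal hae hef hfd (hF.not_cross_of_isEdge hp'.2 hse)
      (hF.not_cross_of_isEdge hp'.2 hsf) (hF.not_cross_of_isEdge hp'.2 hsf')
      (hF.not_cross_of_isEdge hp'.2 (Or.inr hd)) hc)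
  have hnot' : (a, f) ∉ F.erase (e, d) := fun hc => hnot (Finset.mem_erase.1 hc).2
  have hpos := Finset.card_pos.2 ⟨_, hmem⟩
  have hce := Finset.card_erase_of_mem hmem
  refine ⟨insert (a, f) (F.erase (e, d)), ⟨⟨hF, hcard⟩, ⟨hfam, ?_⟩, ?_⟩, ?_⟩
  · rw [Finset.card_insert_of_notMem hnot']
    omega
  · rw [Finset.inter_insert_of_notMem hnot, Finset.inter_eq_right.2 (Finset.erase_subset _ _)]
    omega
  · refine Finset.card_lt_card ⟨fun p hp => ?_, fun hc => ?_⟩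
    · rw [Finset.mem_sdiff] at hp ⊢
      refine ⟨hp.1, fun hpF => hp.2 (Finset.mem_insert_of_mem (Finset.mem_erase.2 ⟨?_, hpF⟩))⟩
      rintro rfl
      have := (mem_fan.1 hp.1).1
      simp only at this
      omega
    · have : (a, f) ∈ fan a b \ F :=
        Finset.mem_sdiff.2 ⟨mem_fan.2 ⟨rfl, by simp only; omega, by simp only; omega⟩, hnot⟩
      exact (Finset.mem_sdiff.1 (hc this)).2 (Finset.mem_insert_self _ _)

theorem IsFull.joined_fan (hab : a < b) (h : IsFull a b F) :
    Relation.ReflTransGen (FullFlip a b) F (fan a b) := by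
  induction hn : (fan a b \ F).card using Nat.strong_induction_on generalizing F with
  | _ n ih =>
    by_cases hs : fan a b ⊆ F
    · have : fan a b = F := Finset.eq_of_subset_of_card_le hs (by
        have := card_fan hab
        have := h.2
        omega)
      rw [this]
    · obtain ⟨G, hG, hlt⟩ := h.exists_fullFlip hab hs
      exact Relation.ReflTransGen.head hG (ih _ (hn ▸ hlt) hG.2.1 rfl)

end Interval

section Punctured

/-- The translate of `p` by `k` full turns. -/
def shift (m : ℕ) (k : ℤ) (p : ℤ × ℤ) : ℤ × ℤ := (p.1 + k * m, p.2 + k * m)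

/-- The representative of the class of `p` whose first entry lies in `[a, a + m)`. -/
def rep (m : ℕ) (a : ℤ) (p : ℤ × ℤ) : ℤ × ℤ := shift m (-((p.1 - a) / m)) p

/-- `S` consists of pairwise non-crossing arcs of `P*_m`. -/
def IsNC (m : ℕ) (S : Finset (ℤ × ℤ)) : Prop :=
  (∀ p ∈ S, IsPArc m p) ∧ ∀ p ∈ S, ∀ q ∈ S, p ≠ q → ¬ PCross m p q

/-- No arc of `S` separates the vertex `a` from the puncture. -/
def Fits (m : ℕ) (a : ℤ) (S : Finset (ℤ × ℤ)) : Prop := ∀ p ∈ S, (rep m a p).2 ≤ a + m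

variable {m : ℕ} {a : ℤ} {S : Finset (ℤ × ℤ)}

theorem IsPTriangulation.isNC (h : IsPTriangulation m S) : IsNC m S := h.2

theorem IsNC.mono {T : Finset (ℤ × ℤ)} (h : IsNC m T) (hST : S ⊆ T) : IsNC m S :=
  ⟨fun p hp => h.1 p (hST hp), fun p hp q hq => h.2 p (hST hp) q (hST hq)⟩

theorem le_rep_fst (hm : 0 < m) (a : ℤ) (p : ℤ × ℤ) : a ≤ (rep m a p).1 := by
  have := Int.emod_nonneg (p.1 - a) (b := m) (by omega)
  have := Int.mul_ediv_add_emod (p.1 - a) m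
  simp only [rep, shift]
  linarith

theorem rep_fst_lt (hm : 0 < m) (a : ℤ) (p : ℤ × ℤ) : (rep m a p).1 < a + m := by
  have := Int.emod_lt_of_pos (p.1 - a) (b := m) (by omega)
  have := Int.mul_ediv_add_emod (p.1 - a) m
  simp only [rep, shift]
  linarith

theorem shift_snd_sub (k : ℤ) (p : ℤ × ℤ) :
    (shift m k p).2 - (shift m k p).1 = p.2 - p.1 := by
  simp only [shift]; ring

theorem rep_snd_sub (a : ℤ) (p : ℤ × ℤ) : (rep m a p).2 - (rep m a p).1 = p.2 - p.1 :=
  shift_snd_sub _ _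

theorem exists_rep_eq_shift (a : ℤ) (p : ℤ × ℤ) : ∃ k, rep m a p = shift m k p := ⟨_, rfl⟩

theorem rep_shift (hm : 0 < m) (a k : ℤ) (p : ℤ × ℤ) : rep m a (shift m k p) = rep m a p := by
  have h : (p.1 + k * m - a) / m = (p.1 - a) / m + k := by
    rw [show p.1 + k * m - a = p.1 - a + k * m by ring, Int.add_mul_ediv_right _ _ (by omega)]
  simp only [rep, shift, h, Prod.mk.injEq]
  constructor <;> ring

theorem rep_rep (hm : 0 < m) (a b : ℤ) (p : ℤ × ℤ) : rep m a (rep m b p) = rep m a p :=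
  rep_shift hm _ _ _

theorem rep_of_mem {p : ℤ × ℤ} (h1 : a ≤ p.1) (h2 : p.1 < a + m) :
    rep m a p = p := by
  have : (p.1 - a) / m = 0 := Int.ediv_eq_zero_of_lt (by omega) (by omega)
  simp [rep, shift, this]

theorem rep_eq_shift_of_mem (hm : 0 < m) {p : ℤ × ℤ} {k : ℤ} (h1 : a ≤ p.1 + k * m)
    (h2 : p.1 + k * m < a + m) : rep m a p = shift m k p := by
  rw [← rep_shift hm a k p]
  exact rep_of_mem h1 h2

theorem pCross_symm {p q : ℤ × ℤ} (h : PCross m p q) : PCross m q p := by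
  obtain ⟨k, hk⟩ := h
  refine ⟨-k, ?_⟩
  rw [neg_mul]
  omega

theorem pCross_shift_left {p q : ℤ × ℤ} (j : ℤ) (h : PCross m (shift m j p) q) :
    PCross m p q := by
  obtain ⟨k, hk⟩ := h
  refine ⟨j + k, ?_⟩
  simp only [shift] at hk
  rw [add_mul]
  omega

theorem pCross_of_rep {p q : ℤ × ℤ} (i j : ℤ) (h : PCross m (rep m i p) (rep m j q)) :
    PCross m p q :=
  pCross_symm (pCross_shift_left _ (pCross_symm (pCross_shift_left _ h)))

theorem CrossLT.pCross {p q : ℤ × ℤ} (h : CrossLT p q) : PCross m p q :=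
  ⟨0, by simp only [CrossLT] at h; simp only [zero_mul]; omega⟩

/-- Chords of `[a, a + m]` cross in `P*_m` only if they cross as chords. -/
theorem PCross.crossLT {p q : ℤ × ℤ} (h : PCross m p q) (hp1 : a ≤ p.1) (hp2 : p.2 ≤ a + m)
    (hq1 : a ≤ q.1) (hq2 : q.2 ≤ a + m) : CrossLT p q ∨ CrossLT q p := by
  obtain ⟨k, hk⟩ := h
  simp only [CrossLT]
  rcases lt_trichotomy k 0 with h0 | rfl | h0
  · have : k * m ≤ -m := by nlinarith
    omega
  · simp only [zero_mul] at hk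
    omega
  · have : (m : ℤ) ≤ k * m := by nlinarith
    omega

theorem isPArc_rep_zero (hm : 0 < m) {p : ℤ × ℤ} (h1 : p.1 + 2 ≤ p.2) (h2 : p.2 ≤ p.1 + m) :
    IsPArc m (rep m 0 p) := by
  have h3 := le_rep_fst hm 0 p
  have h4 := rep_fst_lt hm 0 p
  have h5 := rep_snd_sub (m := m) 0 p
  unfold IsPArc
  omega

theorem IsPArc.rep_zero_rep (hm : 0 < m) {p : ℤ × ℤ} (h : IsPArc m p) (a : ℤ) :
    rep m 0 (rep m a p) = p := by
  rw [rep_rep hm]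
  exact rep_of_mem h.1 (by have := h.2.1; omega)

theorem IsNC.image_rep_zero (hm : 0 < m) (h : IsNC m S) (a : ℤ) :
    (S.image (rep m a)).image (rep m 0) = S := by
  rw [Finset.image_image]
  ext p
  simp only [Finset.mem_image, Function.comp]
  constructor
  · rintro ⟨q, hq, rfl⟩
    rwa [(h.1 q hq).rep_zero_rep hm]
  · exact fun hp => ⟨p, hp, (h.1 p hp).rep_zero_rep hm a⟩

theorem IsNC.card_image_rep (hm : 0 < m) (h : IsNC m S) (a : ℤ) :
    (S.image (rep m a)).card = S.card := by
  refine Finset.card_image_of_injOn fun p hp q hq hpq => ?_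
  rw [← (h.1 p hp).rep_zero_rep hm a, hpq, (h.1 q hq).rep_zero_rep hm a]

/-- Cutting `P*_m` along a vertex `a` turns non-crossing arcs into non-crossing chords. -/
theorem IsNC.isNCFamily (hm : 0 < m) (h : IsNC m S) (hfit : Fits m a S) :
    IsNCFamily a (a + m) (S.image (rep m a)) := by
  simp only [Fits] at hfit
  constructor
  · intro p hp
    obtain ⟨q, hq, rfl⟩ := Finset.mem_image.1 hp
    exact le_rep_fst hm a q
  · intro p hp
    obtain ⟨q, hq, rfl⟩ := Finset.mem_image.1 hp
    have := (h.1 q hq).2.2.1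
    have := rep_snd_sub (m := m) a q
    omega
  · intro p hp
    obtain ⟨q, hq, rfl⟩ := Finset.mem_image.1 hp
    exact hfit q hq
  · intro p hp p' hp' hc
    obtain ⟨q, hq, rfl⟩ := Finset.mem_image.1 hp
    obtain ⟨q', hq', rfl⟩ := Finset.mem_image.1 hp'
    refine h.2 q hq q' hq' ?_ (pCross_of_rep _ _ hc.pCross)
    rintro rfl
    simp only [CrossLT] at hc
    omega

section Family

variable {F : Finset (ℤ × ℤ)}

theorem IsNCFamily.rep_rep_zero (hm : 0 < m) (h : IsNCFamily a (a + m) F) {p : ℤ × ℤ}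
    (hp : p ∈ F) : rep m a (rep m 0 p) = p := by
  rw [rep_rep hm]
  have := h.gap p hp
  have := h.right p hp
  exact rep_of_mem (h.left p hp) (by omega)

theorem IsNCFamily.card_image_rep (hm : 0 < m) (h : IsNCFamily a (a + m) F) :
    (F.image (rep m 0)).card = F.card := by
  refine Finset.card_image_of_injOn fun p hp q hq hpq => ?_
  rw [← h.rep_rep_zero hm hp, hpq, h.rep_rep_zero hm hq]

theorem IsNCFamily.isNC (hm : 0 < m) (h : IsNCFamily a (a + m) F) :
    IsNC m (F.image (rep m 0)) := by
  constructor
  · intro p hp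
    obtain ⟨q, hq, rfl⟩ := Finset.mem_image.1 hp
    have := h.left q hq
    have := h.right q hq
    exact isPArc_rep_zero hm (h.gap q hq) (by omega)
  · intro p hp p' hp' _ hc
    obtain ⟨q, hq, rfl⟩ := Finset.mem_image.1 hp
    obtain ⟨q', hq', rfl⟩ := Finset.mem_image.1 hp'
    rcases (pCross_of_rep _ _ hc).crossLT (h.left q hq) (h.right q hq) (h.left q' hq')
      (h.right q' hq') with hc | hc
    · exact h.nc q hq q' hq' hc
    · exact h.nc q' hq' q hq hc

theorem IsFull.isPTriangulation (hm : 0 < m) (h : IsFull a (a + m) F) :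
    IsPTriangulation m (F.image (rep m 0)) := by
  refine ⟨?_, h.1.isNC hm⟩
  rw [h.1.card_image_rep hm]
  have := h.2
  omega

end Family

/-- A vertex at the end of a longest arc is not separated from the puncture. -/
theorem IsNC.exists_fits (hm : 0 < m) (h : IsNC m S) : ∃ a : ℤ, 0 ≤ a ∧ a < m ∧ Fits m a S := by
  rcases S.eq_empty_or_nonempty with rfl | hS
  · exact ⟨0, le_rfl, by omega, fun p hp => absurd hp (Finset.notMem_empty p)⟩
  · obtain ⟨q, hq, hmax⟩ := Finset.exists_max_image S (fun p : ℤ × ℤ => p.2 - p.1) hS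
    have hqa := h.1 q hq
    refine ⟨q.1, hqa.1, hqa.2.1, fun p hp => ?_⟩
    have h1 := le_rep_fst hm q.1 p
    have h2 := rep_fst_lt hm q.1 p
    have h3 := rep_snd_sub (m := m) q.1 p
    have h4 := hmax p hp
    by_contra hc
    have hne : p ≠ q := by
      rintro rfl
      rw [rep_of_mem le_rfl (by omega)] at hc
      exact hc hqa.2.2.2
    refine h.2 q hq p hp hne.symm (pCross_symm (pCross_shift_left (-((p.1 - q.1) / m)) ?_))
    refine pCross_shift_left (-1) (CrossLT.pCross ?_)
    change CrossLT (shift m (-1) (rep m q.1 p)) q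
    simp only [CrossLT, shift]
    omega

theorem IsNC.fits_of_mem (hm : 0 < m) (h : IsNC m S) (hmem : rep m 0 (a, a + m) ∈ S) :
    Fits m a S := by
  intro p hp
  have h1 := le_rep_fst hm a p
  have h2 := rep_fst_lt hm a p
  have h3 := rep_snd_sub (m := m) a p
  by_contra hc
  by_cases hne : rep m 0 (a, a + m) = p
  · subst hne
    rw [rep_rep hm, rep_of_mem (p := (a, a + m)) le_rfl (by simp only; omega)] at hc
    exact hc le_rfl
  · have hpa := h.1 p hp
    refine h.2 _ hmem p hp hne (pCross_of_rep a a (CrossLT.pCross ?_))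
    rw [rep_rep hm, rep_of_mem (p := (a, a + m)) le_rfl (by simp only; omega)]
    have := hpa.2.2.2
    simp only [CrossLT]
    omega

theorem IsNC.insert_maximal (hm : 2 ≤ m) (h : IsNC m S) (hfit : Fits m a S) :
    IsNC m (insert (rep m 0 (a, a + m)) S) := by
  have hF := (h.isNCFamily (by omega) hfit).insert_top (by omega)
  have := hF.isNC (by omega)
  rwa [Finset.image_insert, h.image_rep_zero (by omega)] at this

theorem IsPTriangulation.isFull (hm : 2 ≤ m) (h : IsPTriangulation m S) (hfit : Fits m a S) :
    IsFull a (a + m) (S.image (rep m a)) := by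
  refine ⟨h.isNC.isNCFamily (by omega) hfit, ?_⟩
  rw [h.isNC.card_image_rep (by omega), h.1]
  omega

theorem IsPTriangulation.exists_maximal (hm : 2 ≤ m) (h : IsPTriangulation m S) :
    ∃ a : ℤ, (a, a + m) ∈ S := by
  obtain ⟨a, h0, ha, hfit⟩ := h.isNC.exists_fits (by omega)
  obtain ⟨hF, hcard⟩ := h.isFull hm hfit
  have hmem := mem_of_insert_of_card hcard (hF.insert_top (by omega))
  refine ⟨a, ?_⟩
  obtain ⟨q, hq, hqe⟩ := Finset.mem_image.1 hmem
  have := (h.isNC.1 q hq).rep_zero_rep (by omega) a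
  rw [hqe, rep_of_mem h0 (by simp only; omega)] at this
  rwa [this]

theorem eq_insert_of_card {T : Finset (ℤ × ℤ)} {x : ℤ × ℤ} (hST : S ⊆ T) (hx : x ∈ T)
    (hxS : x ∉ S) (hcard : T.card = S.card + 1) : T = insert x S := by
  refine (Finset.eq_of_subset_of_card_le (Finset.insert_subset hx hST) ?_).symm
  rw [Finset.card_insert_of_notMem hxS, hcard]

/-- Exactly two triangulations of `P*_m` contain `S`. -/
def HasTwoCompletions (m : ℕ) (S : Finset (ℤ × ℤ)) : Prop :=
  ∃ T₁ T₂ : Finset (ℤ × ℤ), T₁ ≠ T₂ ∧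
    IsPTriangulation m T₁ ∧ S ⊆ T₁ ∧ IsPTriangulation m T₂ ∧ S ⊆ T₂ ∧
    ∀ T, IsPTriangulation m T → S ⊆ T → T = T₁ ∨ T = T₂

/-- It suffices to exhibit the two arcs that complete `S`. -/
theorem hasTwoCompletions_of (hm : 2 ≤ m) (hcard : S.card = m - 2) {x y : ℤ × ℤ} (hxy : x ≠ y)
    (hx : x ∉ S) (hy : y ∉ S) (hxS : IsNC m (insert x S)) (hyS : IsNC m (insert y S))
    (huniq : ∀ T, IsPTriangulation m T → S ⊆ T → x ∈ T ∨ y ∈ T) : HasTwoCompletions m S := by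
  refine ⟨insert x S, insert y S, fun he => ?_, ⟨?_, hxS⟩, Finset.subset_insert _ _, ⟨?_, hyS⟩,
    Finset.subset_insert _ _, fun T hT hST => ?_⟩
  · have : x ∈ insert y S := he ▸ Finset.mem_insert_self x S
    exact (Finset.mem_insert.1 this).elim hxy hx
  · rw [Finset.card_insert_of_notMem hx]; omega
  · rw [Finset.card_insert_of_notMem hy]; omega
  · have hc : T.card = S.card + 1 := by have := hT.1; omega
    exact (huniq T hT hST).imp (fun h => eq_insert_of_card hST h hx hc)
      (fun h => eq_insert_of_card hST h hy hc)

theorem IsNC.rep_zero_mem_iff (hm : 0 < m) (h : IsNC m S) {p : ℤ × ℤ} (h1 : a ≤ p.1)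
    (h2 : p.1 < a + m) : rep m 0 p ∈ S ↔ p ∈ S.image (rep m a) := by
  rw [Finset.mem_image]
  constructor
  · exact fun hp => ⟨_, hp, by rw [rep_rep hm, rep_of_mem h1 h2]⟩
  · rintro ⟨q, hq, rfl⟩
    rwa [(h.1 q hq).rep_zero_rep hm]

/-- A set with a maximal arc is completed by the diagonals of its empty quadrilateral. -/
theorem IsNC.hasTwoCompletions_of_mem (hm : 2 ≤ m) (h : IsNC m S) (hcard : S.card = m - 2)
    (hmem : rep m 0 (a, a + m) ∈ S) : HasTwoCompletions m S := by
  have hm0 : 0 < m := by omega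
  have hF := h.isNCFamily hm0 (h.fits_of_mem hm0 hmem)
  have hFc : ((S.image (rep m a)).card : ℤ) + 2 = a + m - a := by
    rw [h.card_image_rep hm0]; omega
  have htop := (h.rep_zero_mem_iff hm0 (a := a) (p := (a, a + m)) le_rfl
    (by simp only; omega)).1 hmem
  obtain ⟨c, g, f, d, hq⟩ := hF.exists_isQuad hFc htop
  have hca := hF.left _ hq.side₄
  have hda := hF.right _ hq.side₄
  have h1 := hq.lt₁
  have h2 := hq.lt₂
  have h3 := hq.lt₃
  simp only at hca hda
  have hx := h.rep_zero_mem_iff hm0 (a := a) (p := (c, f)) hca (by simp only; omega)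
  have hy := h.rep_zero_mem_iff hm0 (a := a) (p := (g, d)) (by simp only; omega)
    (by simp only; omega)
  have hxS := (hq.insert_diag₁ hF).isNC hm0
  have hyS := (hq.insert_diag₂ hF).isNC hm0
  rw [Finset.image_insert, h.image_rep_zero hm0] at hxS hyS
  refine hasTwoCompletions_of hm hcard (x := rep m 0 (c, f)) (y := rep m 0 (g, d)) ?_
    (fun hc => hq.diag₁ (hx.1 hc)) (fun hc => hq.diag₂ (hy.1 hc)) hxS hyS fun T hT hST => ?_
  · intro he
    have he := congrArg (rep m a) he
    rw [rep_rep hm0, rep_rep hm0, rep_of_mem (p := (c, f)) hca (by simp only; omega),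
      rep_of_mem (p := (g, d)) (by simp only; omega) (by simp only; omega)] at he
    exact h1.ne (congrArg Prod.fst he)
  · have hTF := hT.isFull hm (hT.isNC.fits_of_mem hm0 (hST hmem))
    have hsub : S.image (rep m a) ⊆ T.image (rep m a) := Finset.image_subset_image hST
    obtain ⟨z, hzT, hzF⟩ := Finset.exists_mem_notMem_of_card_lt_card
      (s := S.image (rep m a)) (t := T.image (rep m a)) (by have := hTF.2; omega)
    have hz := hq.eq_diag hF hFc hzF (hTF.1.mono (Finset.insert_subset hzT hsub))
    have hz1 := hTF.1.left z hzT
    have hz2 := hTF.1.right z hzT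
    have hz3 := hTF.1.gap z hzT
    have hzT' := (hT.isNC.rep_zero_mem_iff hm0 hz1 (by omega)).2 hzT
    rcases hz with rfl | rfl
    exacts [Or.inl hzT', Or.inr hzT']

/-- A set without maximal arcs surrounds the puncture by a digon, and is completed by either of
the maximal arcs of this digon. -/
theorem IsNC.hasTwoCompletions_of_notMem (hm : 2 ≤ m) (h : IsNC m S) (hcard : S.card = m - 2)
    (hfit : Fits m a S) (hmem : rep m 0 (a, a + m) ∉ S) : HasTwoCompletions m S := by
  have hm0 : 0 < m := by omega
  have hF := h.isNCFamily hm0 hfit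
  have hFc : ((S.image (rep m a)).card : ℤ) + 2 = a + m - a := by
    rw [h.card_image_rep hm0]; omega
  have htop := mt (h.rep_zero_mem_iff hm0 (a := a) (p := (a, a + m)) le_rfl
    (by simp only; omega)).2 hmem
  obtain ⟨f, haf, hfm, he₁, he₂, hf⟩ := hF.exists_split_of_card hFc htop
  have hfit' : Fits m f S := by
    intro p hp
    have hpF := Finset.mem_image_of_mem (rep m a) hp
    have h1 := hF.left _ hpF
    have h2 := hF.right _ hpF
    have h3 := hF.gap _ hpF
    have h4 := hf _ hpF
    rw [← rep_rep hm0 f a p]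
    by_cases hc : f ≤ (rep m a p).1
    · rw [rep_of_mem hc (by omega)]
      omega
    · rw [rep_eq_shift_of_mem hm0 (k := 1) (by omega) (by omega)]
      simp only [shift]
      omega
  have hne : rep m 0 (f, f + m) ∉ S := by
    intro hc
    have h1 := (h.rep_zero_mem_iff hm0 (a := a) (p := (f, f + m)) haf.le hfm).1 hc
    have := hF.right _ h1
    simp only at this
    omega
  refine hasTwoCompletions_of hm hcard (x := rep m 0 (a, a + m)) (y := rep m 0 (f, f + m)) ?_
    hmem hne (h.insert_maximal hm hfit) (h.insert_maximal hm hfit') fun T hT hST => ?_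
  · intro he
    have he := congrArg (rep m a) he
    rw [rep_rep hm0, rep_rep hm0, rep_of_mem (p := (a, a + m)) le_rfl (by simp only; omega),
      rep_of_mem (p := (f, f + m)) haf.le hfm] at he
    exact haf.ne (congrArg Prod.fst he)
  · obtain ⟨e, he⟩ := hT.exists_maximal hm
    obtain ⟨k, hk⟩ := exists_rep_eq_shift (m := m) a (e, e + m)
    obtain ⟨e', he'⟩ : ∃ e', e' = e + k * m := ⟨_, rfl⟩
    have hre : rep m a (e, e + m) = (e', e' + m) := by
      rw [hk, he']
      simp only [shift, Prod.mk.injEq, true_and]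
      ring
    have h1 : a ≤ e' := by have := le_rep_fst hm0 a (e, e + m); rwa [hre] at this
    have h2 : e' < a + m := by have := rep_fst_lt hm0 a (e, e + m); rwa [hre] at this
    have hmemT : rep m 0 (e', e' + m) ∈ T := by
      rw [← hre, (hT.isNC.1 _ he).rep_zero_rep hm0]
      exact he
    have hbad : ∀ c d, a ≤ c → d ≤ a + m → IsEdge (S.image (rep m a)) c d →
        ¬ (c < e' ∧ e' < d) := by
      rintro c d hc hd (rfl | hed) ⟨h3, h4⟩
      · omega
      · have hgap := hF.gap _ hed
        have hS := (h.rep_zero_mem_iff hm0 (a := a) (p := (c, d)) hc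
          (by simp only at *; omega)).2 hed
        have hTf := hT.isNC.fits_of_mem hm0 hmemT _ (hST hS)
        rw [rep_rep hm0, rep_eq_shift_of_mem hm0 (k := 1) (by simp only; omega)
          (by simp only; omega)] at hTf
        simp only [shift] at hTf
        omega
    have h3 := hbad a f le_rfl hfm.le he₁
    have h4 := hbad f (a + m) haf.le le_rfl he₂
    have : e' = a ∨ e' = f := by omega
    rcases this with h | h <;> rw [h] at hmemT
    exacts [Or.inl hmemT, Or.inr hmemT]

theorem IsNC.hasTwoCompletions (hm : 2 ≤ m) (h : IsNC m S) (hcard : S.card = m - 2) :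
    HasTwoCompletions m S := by
  obtain ⟨a, -, -, hfit⟩ := h.exists_fits (by omega)
  by_cases hmem : rep m 0 (a, a + m) ∈ S
  · exact h.hasTwoCompletions_of_mem hm hcard hmem
  · exact h.hasTwoCompletions_of_notMem hm hcard hfit hmem

/-- Two triangulations of `P*_m` that differ by a flip. -/
def Flip (m : ℕ) (T T' : Finset (ℤ × ℤ)) : Prop :=
  IsPTriangulation m T ∧ IsPTriangulation m T' ∧ (T ∩ T').card = m - 2

theorem FullFlip.flip {F G : Finset (ℤ × ℤ)} (hm : 2 ≤ m) (h : FullFlip a (a + m) F G) :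
    Flip m (F.image (rep m 0)) (G.image (rep m 0)) := by
  have hm0 : 0 < m := by omega
  refine ⟨h.1.isPTriangulation hm0, h.2.1.isPTriangulation hm0, ?_⟩
  have hi : F.image (rep m 0) ∩ G.image (rep m 0) = (F ∩ G).image (rep m 0) := by
    ext p
    simp only [Finset.mem_inter, Finset.mem_image]
    constructor
    · rintro ⟨⟨q, hq, rfl⟩, q', hq', he⟩
      have he' := congrArg (rep m a) he
      rw [h.1.1.rep_rep_zero hm0 hq, h.2.1.1.rep_rep_zero hm0 hq'] at he'
      exact ⟨q, ⟨hq, he' ▸ hq'⟩, rfl⟩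
    · rintro ⟨q, ⟨hq, hq'⟩, rfl⟩
      exact ⟨⟨q, hq, rfl⟩, q, hq', rfl⟩
  rw [hi, (h.1.1.mono Finset.inter_subset_left).card_image_rep hm0]
  have := h.2.2
  omega

theorem Flip.symm {T T' : Finset (ℤ × ℤ)} (h : Flip m T T') : Flip m T' T :=
  ⟨h.2.1, h.1, by rw [Finset.inter_comm]; exact h.2.2⟩

theorem IsFull.joined_fan_image (hm : 2 ≤ m) {F : Finset (ℤ × ℤ)} (h : IsFull a (a + m) F) :
    Relation.ReflTransGen (Flip m) (F.image (rep m 0)) ((fan a (a + m)).image (rep m 0)) :=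
  (h.joined_fan (by omega)).lift _ fun _ _ hab => hab.flip hm

theorem image_rep_zero_of_mem {F : Finset (ℤ × ℤ)}
    (hF : ∀ p ∈ F, 0 ≤ p.1 ∧ p.1 < m) : F.image (rep m 0) = F := by
  have : ∀ p ∈ F, rep m 0 p = p := fun p hp => rep_of_mem (hF p hp).1 (by
    have := (hF p hp).2
    omega)
  rw [Finset.image_congr (g := id) fun p hp => this p hp, Finset.image_id]

/-- The fan at `a + 1` with its maximal arc replaced by the maximal arc based at `a`. -/
noncomputable def rotatedFan (m : ℕ) (a : ℤ) : Finset (ℤ × ℤ) :=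
  insert (a, a + m) ((fan (a + 1) (a + 1 + m)).erase (a + 1, a + 1 + m))

theorem isFull_rotatedFan (hm : 2 ≤ m) (a : ℤ) : IsFull a (a + m) (rotatedFan m a) := by
  have hsub : (fan (a + 1) (a + 1 + m)).erase (a + 1, a + 1 + m) = fan (a + 1) (a + m) := by
    ext ⟨x, y⟩
    simp only [Finset.mem_erase, mem_fan, ne_eq, Prod.mk.injEq]
    omega
  have hfam : IsNCFamily a (a + m) (fan (a + 1) (a + m)) := by
    refine ⟨fun p hp => ?_, isNCFamily_fan.gap, isNCFamily_fan.right, isNCFamily_fan.nc⟩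
    have := isNCFamily_fan.left p hp
    omega
  have hcard := card_fan (a := a + 1) (b := a + m) (by omega)
  have hnot : (a, a + (m : ℤ)) ∉ fan (a + 1) (a + m) := fun hc => by
    have := (mem_fan.1 hc).1
    simp only at this
    omega
  rw [rotatedFan, hsub]
  refine ⟨hfam.insert_top (by omega), ?_⟩
  rw [Finset.card_insert_of_notMem hnot]
  push_cast
  omega

theorem image_rep_zero_fan (h0 : 0 ≤ a) (ha : a < m) (b : ℤ) :
    (fan a b).image (rep m 0) = fan a b :=
  image_rep_zero_of_mem fun p hp => by rw [(mem_fan.1 hp).1]; exact ⟨h0, ha⟩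

theorem image_rep_zero_rotatedFan (h0 : 0 ≤ a) (ha : a + 1 < m) :
    (rotatedFan m a).image (rep m 0) = rotatedFan m a :=
  image_rep_zero_of_mem fun p hp => by
    rcases Finset.mem_insert.1 hp with rfl | hp
    · simp only; omega
    · rw [(mem_fan.1 (Finset.mem_erase.1 hp).2).1]; omega

theorem flip_fan_rotatedFan (hm : 2 ≤ m) (h0 : 0 ≤ a) (ha : a + 1 < m) :
    Flip m (fan (a + 1) (a + 1 + m)) (rotatedFan m a) := by
  have hm0 : 0 < m := by omega
  have h1 : IsFull (a + 1) (a + 1 + m) (fan (a + 1) (a + 1 + m)) :=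
    ⟨isNCFamily_fan, card_fan (by omega)⟩
  have h2 := h1.isPTriangulation hm0
  have h3 := (isFull_rotatedFan hm a).isPTriangulation hm0
  rw [image_rep_zero_fan (by omega) ha] at h2
  rw [image_rep_zero_rotatedFan h0 ha] at h3
  refine ⟨h2, h3, ?_⟩
  have hnot : (a, a + (m : ℤ)) ∉ fan (a + 1) (a + 1 + m) := fun hc => by
    have := (mem_fan.1 hc).1
    simp only at this
    omega
  have hmem : (a + 1, a + 1 + (m : ℤ)) ∈ fan (a + 1) (a + 1 + m) :=
    mem_fan.2 ⟨rfl, by simp only; omega, le_rfl⟩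
  rw [rotatedFan, Finset.inter_insert_of_notMem hnot,
    Finset.inter_eq_right.2 (Finset.erase_subset _ _), Finset.card_erase_of_mem hmem]
  have := h1.2
  omega

theorem IsFull.joined_fan_zero (hm : 2 ≤ m) {n : ℕ} (hn : n < m) {F : Finset (ℤ × ℤ)}
    (h : IsFull n (n + m) F) :
    Relation.ReflTransGen (Flip m) (F.image (rep m 0)) (fan 0 m) := by
  induction n generalizing F with
  | zero =>
    have := h.joined_fan_image hm
    rw [image_rep_zero_fan (by simp) (by omega)] at this
    simpa using this
  | succ n ih =>
    have h1 := h.joined_fan_image hm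
    have h2 := ih (by omega) (isFull_rotatedFan hm n)
    have h3 := flip_fan_rotatedFan hm (a := n) (by omega) (by omega)
    rw [image_rep_zero_fan (by omega) (by omega)] at h1
    rw [image_rep_zero_rotatedFan (by omega) (by omega)] at h2
    push_cast at h1
    exact h1.trans (Relation.ReflTransGen.head h3 h2)

theorem IsPTriangulation.joined_fan_zero (hm : 2 ≤ m) (h : IsPTriangulation m S) :
    Relation.ReflTransGen (Flip m) S (fan 0 m) := by
  obtain ⟨a, h0, ha, hfit⟩ := h.isNC.exists_fits (by omega)
  lift a to ℕ using h0
  have := (h.isFull hm hfit).joined_fan_zero hm (by omega)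
  rwa [h.isNC.image_rep_zero (by omega)] at this

theorem flipJoined_of_reflTransGen {T₁ T₂ : Finset (ℤ × ℤ)} (h2 : IsPTriangulation m T₂)
    (h : Relation.ReflTransGen (Flip m) T₁ T₂) : FlipJoined m T₁ T₂ := by
  induction h using Relation.ReflTransGen.head_induction_on with
  | refl => exact ⟨0, fun _ => T₂, rfl, rfl, fun _ => h2, fun i => i.elim0⟩
  | @head T T' hT _ ih =>
    obtain ⟨n, f, hf0, hfl, hft, hfs⟩ := ih
    refine ⟨n + 1, Fin.cons T f, rfl, ?_, fun i => ?_, fun i => ?_⟩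
    · rw [← Fin.succ_last, Fin.cons_succ, hfl]
    · refine Fin.cases ?_ (fun j => ?_) i
      · exact hT.1
      · exact hft j
    · refine Fin.cases ?_ (fun j => ?_) i
      · rw [Fin.castSucc_zero, Fin.cons_zero, Fin.cons_succ, hf0]
        exact hT.2.2
      · rw [Fin.castSucc_succ, Fin.cons_succ, Fin.cons_succ]
        exact hfs j

theorem IsPTriangulation.flipJoined (hm : 2 ≤ m) {T₁ T₂ : Finset (ℤ × ℤ)}
    (h1 : IsPTriangulation m T₁) (h2 : IsPTriangulation m T₂) : FlipJoined m T₁ T₂ :=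
  have : Std.Symm (Flip m) := ⟨fun _ _ h => h.symm⟩
  flipJoined_of_reflTransGen h2 <| (h1.joined_fan_zero hm).trans <|
    Relation.ReflTransGen.stdSymm.symm _ _ (h2.joined_fan_zero hm)

end Punctured

/-- For `P*_m` (`m ≥ 2`): every set of `m - 2` pairwise non-crossing
arcs is contained in exactly two triangulations, and any two triangulations are joined
by a finite sequence of triangulations in which consecutive triangulations share exactly
`m - 2` arcs. -/
theorem arc_complex_pseudomanifold (m : ℕ) (hm : 2 ≤ m) :
    (∀ S : Finset (ℤ × ℤ), S.card = m - 2 →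
        (∀ p ∈ S, IsPArc m p) →
        (∀ p ∈ S, ∀ q ∈ S, p ≠ q → ¬ PCross m p q) →
        ∃ T₁ T₂ : Finset (ℤ × ℤ), T₁ ≠ T₂ ∧
          IsPTriangulation m T₁ ∧ S ⊆ T₁ ∧ IsPTriangulation m T₂ ∧ S ⊆ T₂ ∧
          ∀ T, IsPTriangulation m T → S ⊆ T → T = T₁ ∨ T = T₂) ∧
    (∀ T₁ T₂ : Finset (ℤ × ℤ),
        IsPTriangulation m T₁ → IsPTriangulation m T₂ → FlipJoined m T₁ T₂) := by
  exact ⟨fun S hcard hS hnc => IsNC.hasTwoCompletions hm ⟨hS, hnc⟩ hcard,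
    fun T₁ T₂ h1 h2 => h1.flipJoined hm h2⟩

end Punc
end
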